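/- arXiv:1203.1758 — 4 statements merged into one kernel-verified Lean document; each statement's English description precedes it below -/
import Mathlib

section
/- For every rate-tuple r = (r_1, ..., r_K) lying on the Pareto boundary of the achievable rate region R, there exist nonnegative interference-leakage levels α_{ji} ≥ 0 (for all i and all j ≠ i) and beamforming vectors v_1*, ..., v_K* ∈ ℂ^N with ‖v_i*‖² ≤ P_i such that: (a) for each i, v_i* maximizes |⟨h_{ii}, v⟩|² over the set {v ∈ ℂ^N : |⟨h_{ji}, v⟩|² ≤ α_{ji} σ_j² for all j ≠ i, and ‖v‖² ≤ P_i}; and (b) (R_1(v_1*,...,v_K*), ..., R_K(v_1*,...,v_K*)) = r. -/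
open scoped ComplexInnerProductSpace

/-- Rate of user `i` in a `K`-pair MISO interference channel with channels `h`
(`h i j` is the channel from transmitter `j` to receiver `i`), noise std `σ`,
and beamforming vectors `v`. -/
noncomputable def rate {K N : ℕ} (h : Fin K → Fin K → EuclideanSpace ℂ (Fin N))
    (σ : Fin K → ℝ) (v : Fin K → EuclideanSpace ℂ (Fin N)) (i : Fin K) : ℝ :=
  Real.log (1 + ‖⟪h i i, v i⟫‖ ^ 2 /
    ((σ i) ^ 2 + ∑ j ∈ Finset.univ.erase i, ‖⟪h i j, v j⟫‖ ^ 2))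

/-- The achievable rate region with per-transmitter power budgets `P`. -/
noncomputable def rateRegion {K N : ℕ} (h : Fin K → Fin K → EuclideanSpace ℂ (Fin N))
    (σ P : Fin K → ℝ) : Set (Fin K → ℝ) :=
  {r | ∃ v : Fin K → EuclideanSpace ℂ (Fin N),
    (∀ i, ‖v i‖ ^ 2 ≤ P i) ∧ r = rate h σ v}

/-- Every rate-tuple on the Pareto boundary of the achievable rate region is achieved by
beam vectors that, for suitable nonnegative interference-leakage levels `α j i`,
solve the relaxed zero-forcing (RZF) problem at each transmitter. -/
theorem pareto_boundary_achieved_by_RZF {K N : ℕ}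
    (h : Fin K → Fin K → EuclideanSpace ℂ (Fin N)) (σ P : Fin K → ℝ)
    (hσ : ∀ i, 0 < σ i) (hP : ∀ i, 0 < P i)
    (r : Fin K → ℝ) (hr : r ∈ rateRegion h σ P)
    (hpareto : ¬ ∃ r' ∈ rateRegion h σ P, (∀ i, r i ≤ r' i) ∧ r' ≠ r) :
    ∃ (α : Fin K → Fin K → ℝ) (v : Fin K → EuclideanSpace ℂ (Fin N)),
      (∀ i j, j ≠ i → 0 ≤ α j i) ∧
      (∀ i, ‖v i‖ ^ 2 ≤ P i) ∧
      (∀ i,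
        (∀ j, j ≠ i → ‖⟪h j i, v i⟫‖ ^ 2 ≤ α j i * (σ j) ^ 2) ∧
        (∀ w : EuclideanSpace ℂ (Fin N),
          (∀ j, j ≠ i → ‖⟪h j i, w⟫‖ ^ 2 ≤ α j i * (σ j) ^ 2) → ‖w‖ ^ 2 ≤ P i →
          ‖⟪h i i, w⟫‖ ^ 2 ≤ ‖⟪h i i, v i⟫‖ ^ 2)) ∧
      rate h σ v = r := by
  obtain ⟨v, hv, rfl⟩ := hr
  have hcan : ∀ i j, ‖⟪h j i, v i⟫‖ ^ 2 / (σ j) ^ 2 * (σ j) ^ 2 = ‖⟪h j i, v i⟫‖ ^ 2 := by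
    intro i j
    have := (hσ j).ne'
    field_simp
  refine ⟨fun j i => ‖⟪h j i, v i⟫‖ ^ 2 / (σ j) ^ 2, v, fun i j _ => by positivity, hv,
    fun i => ⟨fun j _ => (hcan i j).ge, ?_⟩, rfl⟩
  intro w hw hwP
  by_contra hlt
  rw [not_le] at hlt
  apply hpareto
  have hden : ∀ (u : Fin K → EuclideanSpace ℂ (Fin N)) (k : Fin K),
      0 < (σ k) ^ 2 + ∑ j ∈ Finset.univ.erase k, ‖⟪h k j, u j⟫‖ ^ 2 := by
    intro u k
    have h1 : 0 < (σ k) ^ 2 := pow_pos (hσ k) 2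
    have h2 : 0 ≤ ∑ j ∈ Finset.univ.erase k, ‖⟪h k j, u j⟫‖ ^ 2 :=
      Finset.sum_nonneg fun _ _ => by positivity
    linarith
  have hi : rate h σ v i < rate h σ (Function.update v i w) i := by
    unfold rate
    have hs : ∑ j ∈ Finset.univ.erase i, ‖⟪h i j, Function.update v i w j⟫‖ ^ 2
        = ∑ j ∈ Finset.univ.erase i, ‖⟪h i j, v j⟫‖ ^ 2 := by
      refine Finset.sum_congr rfl fun j hj => ?_
      rw [Function.update_of_ne (Finset.ne_of_mem_erase hj)]
    rw [hs, Function.update_self]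
    have hd := hden v i
    apply Real.log_lt_log
    · have := div_nonneg (sq_nonneg ‖⟪h i i, v i⟫‖) hd.le
      linarith
    · have := div_lt_div_of_pos_right hlt hd
      linarith
  refine ⟨_, ⟨Function.update v i w, ?_, rfl⟩, ?_, ?_⟩
  · intro k
    by_cases hk : k = i
    · subst hk
      simpa using hwP
    · simpa [Function.update_of_ne hk] using hv k
  · intro k
    by_cases hk : k = i
    · subst hk
      exact hi.le
    · unfold rate
      rw [Function.update_of_ne hk]
      have hd := hden v k
      have hd' := hden (Function.update v i w) k
      apply Real.log_le_log
      · have := div_nonneg (sq_nonneg ‖⟪h k k, v k⟫‖) hd.le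
        linarith
      · have hs : ∑ j ∈ Finset.univ.erase k, ‖⟪h k j, Function.update v i w j⟫‖ ^ 2
            ≤ ∑ j ∈ Finset.univ.erase k, ‖⟪h k j, v j⟫‖ ^ 2 := by
          refine Finset.sum_le_sum fun j _ => ?_
          by_cases hj : j = i
          · subst hj
            rw [Function.update_self]
            exact (hw k hk).trans (hcan j k).le
          · rw [Function.update_of_ne hj]
        have := div_le_div_of_nonneg_left (sq_nonneg ‖⟪h k k, v k⟫‖) hd'
          (add_le_add_right hs ((σ k) ^ 2))
        linarith
  · intro he
    rw [he] at hi
    exact lt_irrefl _ hi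
end

section
/- Fix transmitter i and suppose v* maximizes |⟨h_{ii}, v⟩|² over the feasible set F_i = {v ∈ ℂ^N : |⟨h_{ji}, v⟩|² ≤ α_{ji} σ_j² for all j ≠ i, and ‖v‖² ≤ P_i}, where P_i > 0, σ_j > 0 and α_{ji} > 0 for all j ≠ i. Assume the channel vectors are in general position: every subset of {h_{ii}} ∪ {h_{ji} : j ≠ i} of cardinality at most N is linearly independent. Let Γ_i = { j ≠ i : |⟨h_{ji}, v*⟩|² = α_{ji} σ_j² } be the set of tight interference constraints. Then v* lies in the linear span of {h_{ii}} ∪ {h_{ji} : j ∈ Γ_i}; i.e., v* = c_{ii} h_{ii} + Σ_{j ∈ Γ_i} c_{ji} h_{ji} for some complex coefficients c_{ii}, c_{ji}. -/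
open scoped ComplexInnerProductSpace

/-- Structure of the RZF-optimal beamforming vector: if `v` maximizes `|⟨h i i, ·⟩|²`
over the RZF feasible set at transmitter `i`, and the channel vectors are in general
position, then `v` lies in the span of the desired channel `h i i` together with the
interference channels whose leakage constraints are tight. -/
theorem RZF_solution_in_span_of_tight_channels {K N : ℕ} (i : Fin K)
    (h : Fin K → Fin K → EuclideanSpace ℂ (Fin N))
    (σ : Fin K → ℝ) (α : Fin K → Fin K → ℝ) (Pi : ℝ)
    (hPi : 0 < Pi) (hσ : ∀ j, 0 < σ j) (hα : ∀ j, j ≠ i → 0 < α j i)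
    (hgen : ∀ s : Finset (Fin K), s.card ≤ N →
      LinearIndependent ℂ (fun j : s => h j i))
    (v : EuclideanSpace ℂ (Fin N))
    (hfeas : (∀ j, j ≠ i → ‖⟪h j i, v⟫‖ ^ 2 ≤ α j i * (σ j) ^ 2) ∧ ‖v‖ ^ 2 ≤ Pi)
    (hopt : ∀ w : EuclideanSpace ℂ (Fin N),
      (∀ j, j ≠ i → ‖⟪h j i, w⟫‖ ^ 2 ≤ α j i * (σ j) ^ 2) → ‖w‖ ^ 2 ≤ Pi →
      ‖⟪h i i, w⟫‖ ^ 2 ≤ ‖⟪h i i, v⟫‖ ^ 2) :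
    v ∈ Submodule.span ℂ
      (insert (h i i)
        {x | ∃ j, j ≠ i ∧ ‖⟪h j i, v⟫‖ ^ 2 = α j i * (σ j) ^ 2 ∧ x = h j i}) := by
  classical
  set T : Set (EuclideanSpace ℂ (Fin N)) :=
    {x | ∃ j, j ≠ i ∧ ‖⟪h j i, v⟫‖ ^ 2 = α j i * (σ j) ^ 2 ∧ x = h j i} with hT
  set S := Submodule.span ℂ (insert (h i i) T) with hS
  by_contra hv
  obtain ⟨hf1, hf2⟩ := hfeas
  let G : Finset (Fin K) := Finset.univ.filter
    (fun j => j ≠ i ∧ ‖⟪h j i, v⟫‖ ^ 2 = α j i * (σ j) ^ 2)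
  have hmem : ∀ j ∈ insert i G, h j i ∈ S := by
    intro j hj
    apply Submodule.subset_span
    rcases Finset.mem_insert.1 hj with rfl | hj
    · exact Set.mem_insert _ _
    · have := (Finset.mem_filter.1 hj).2
      exact Set.mem_insert_of_mem _ ⟨j, this.1, this.2, rfl⟩
  have hcard : (insert i G).card ≤ N := by
    by_contra hc
    push Not at hc
    obtain ⟨s, hs, hsc⟩ := Finset.exists_subset_card_eq hc.le
    have hli := hgen s hsc.le
    have htop := hli.span_eq_top_of_card_eq_finrank' (by simp [hsc])
    apply hv
    have : (⊤ : Submodule ℂ (EuclideanSpace ℂ (Fin N))) ≤ S := by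
      rw [← htop, Submodule.span_le]
      rintro _ ⟨j, rfl⟩
      exact hmem j (hs j.2)
    exact this trivial
  have hnot : h i i ∉ Submodule.span ℂ T := by
    have hli := hgen _ hcard
    have := hli.notMem_span_image (s := {j | (j : Fin K) ∈ G})
      (x := ⟨i, Finset.mem_insert_self _ _⟩) (by simp [G])
    intro hh
    apply this
    refine Submodule.span_mono ?_ hh
    rintro _ ⟨j, hj1, hj2, rfl⟩
    have hjG : j ∈ G := Finset.mem_filter.2 ⟨Finset.mem_univ _, hj1, hj2⟩
    exact ⟨⟨j, Finset.mem_insert_of_mem hjG⟩, hjG, rfl⟩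
  -- the ascent direction
  obtain ⟨d, hd1, hd2⟩ : ∃ d : EuclideanSpace ℂ (Fin N),
      (∀ x ∈ T, ⟪x, d⟫ = 0) ∧ ⟪h i i, d⟫ ≠ 0 := by
    by_contra hcon
    push Not at hcon
    apply hnot
    rw [← Submodule.orthogonal_orthogonal (Submodule.span ℂ T), Submodule.mem_orthogonal']
    intro d hd
    exact hcon d fun x hx => (Submodule.mem_orthogonal _ _).1 hd x (Submodule.subset_span hx)
  obtain ⟨c, hc⟩ : ∃ c : ℂ, ∀ t : ℝ, 0 < t → ‖⟪h i i, v⟫‖ < ‖⟪h i i, v⟫ + t * c‖ := by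
    by_cases ha : ⟪h i i, v⟫ = 0
    · refine ⟨1, fun t ht => ?_⟩
      simp [ha, ht.ne']
    · refine ⟨⟪h i i, v⟫, fun t ht => ?_⟩
      have : ⟪h i i, v⟫ + t * ⟪h i i, v⟫ = ((1 + t : ℝ) : ℂ) * ⟪h i i, v⟫ := by
        push_cast; ring
      rw [this, norm_mul, Complex.norm_real, Real.norm_of_nonneg (by linarith)]
      have := norm_pos_iff.2 ha
      nlinarith
  -- orthogonal decomposition
  obtain ⟨p, hp, q, hq, hpq⟩ := S.exists_add_mem_mem_orthogonal v
  have hq0 : q ≠ 0 := by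
    rintro rfl
    apply hv
    rw [hpq, add_zero]; exact hp
  have hSq : ∀ x ∈ S, ⟪x, q⟫ = 0 := fun x hx => (Submodule.mem_orthogonal _ _).1 hq x hx
  have hvq : RCLike.re ⟪v, q⟫ = ‖q‖ ^ 2 := by
    rw [hpq, inner_add_left, hSq p hp, zero_add, inner_self_eq_norm_sq]
  have hqpos : 0 < ‖q‖ ^ 2 := by positivity
  obtain ⟨u, hu1, hu2, hu3⟩ : ∃ u : EuclideanSpace ℂ (Fin N), (∀ x ∈ S, ⟪x, u⟫ = ⟪x, v⟫) ∧
      ‖u‖ ^ 2 < Pi ∧ ∀ j, j ≠ i → ‖⟪h j i, v⟫‖ ^ 2 ≠ α j i * (σ j) ^ 2 →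
        ‖⟪h j i, u⟫‖ ^ 2 < α j i * (σ j) ^ 2 := by
    have hev : ∀ᶠ t : ℝ in nhdsWithin 0 (Set.Ioi 0),
        ∀ j, j ≠ i → ‖⟪h j i, v⟫‖ ^ 2 ≠ α j i * (σ j) ^ 2 →
        ‖⟪h j i, v - (t : ℂ) • q⟫‖ ^ 2 < α j i * (σ j) ^ 2 := by
      rw [Filter.eventually_all]
      intro j
      by_cases hj : j ≠ i ∧ ‖⟪h j i, v⟫‖ ^ 2 ≠ α j i * (σ j) ^ 2
      · have hcont : Continuous fun t : ℝ => ‖⟪h j i, v - (t : ℂ) • q⟫‖ ^ 2 := by fun_prop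
        have := hcont.continuousAt.eventually_lt (continuousAt_const (x := (0 : ℝ)))
          (by simpa using lt_of_le_of_ne (hf1 j hj.1) hj.2)
        filter_upwards [nhdsWithin_le_nhds this] with t ht _ _ using ht
      · filter_upwards with t h1 h2 using absurd ⟨h1, h2⟩ hj
    obtain ⟨t, ht, ht0, ht1⟩ :=
      (hev.and (Ioo_mem_nhdsGT (zero_lt_one' ℝ))).exists
    refine ⟨v - (t : ℂ) • q, fun x hx => ?_, ?_, ht⟩
    · rw [inner_sub_right, inner_smul_right, hSq x hx, mul_zero, sub_zero]
    · have e : ‖v - (t : ℂ) • q‖ ^ 2 = ‖v‖ ^ 2 - 2 * (t * ‖q‖ ^ 2) + t ^ 2 * ‖q‖ ^ 2 := by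
        rw [@norm_sub_sq ℂ, inner_smul_right, ← hvq, norm_smul, Complex.norm_real, mul_pow,
          Real.norm_eq_abs, sq_abs]
        simp
        exact Or.inl hvq.symm
      rw [e]
      nlinarith [mul_pos ht0 hqpos, mul_pos (mul_pos ht0 hqpos) (sub_pos.2 ht1)]
  have hev : ∀ᶠ t : ℝ in nhdsWithin 0 (Set.Ioi 0),
      ‖u + (t : ℂ) • (c / ⟪h i i, d⟫) • d‖ ^ 2 < Pi ∧
      ∀ j, j ≠ i → ‖⟪h j i, v⟫‖ ^ 2 ≠ α j i * (σ j) ^ 2 →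
      ‖⟪h j i, u + (t : ℂ) • (c / ⟪h i i, d⟫) • d⟫‖ ^ 2 < α j i * (σ j) ^ 2 := by
    apply Filter.Eventually.and
    · have hcont : Continuous fun t : ℝ => ‖u + (t : ℂ) • (c / ⟪h i i, d⟫) • d‖ ^ 2 := by fun_prop
      exact nhdsWithin_le_nhds (hcont.continuousAt.eventually_lt
        (continuousAt_const (x := (0 : ℝ))) (by simpa using hu2))
    rw [Filter.eventually_all]
    intro j
    by_cases hj : j ≠ i ∧ ‖⟪h j i, v⟫‖ ^ 2 ≠ α j i * (σ j) ^ 2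
    · have hcont : Continuous fun t : ℝ =>
          ‖⟪h j i, u + (t : ℂ) • (c / ⟪h i i, d⟫) • d⟫‖ ^ 2 := by fun_prop
      have := hcont.continuousAt.eventually_lt (continuousAt_const (x := (0 : ℝ)))
        (by simpa using hu3 j hj.1 hj.2)
      filter_upwards [nhdsWithin_le_nhds this] with t ht _ _ using ht
    · filter_upwards with t h1 h2 using absurd ⟨h1, h2⟩ hj
  obtain ⟨t, ⟨htP, ht⟩, ht0⟩ := (hev.and self_mem_nhdsWithin).exists
  have hfin := hopt (u + (t : ℂ) • (c / ⟪h i i, d⟫) • d) (fun j hj => ?_) htP.le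
  · have hi := hu1 (h i i) (Submodule.subset_span (Set.mem_insert _ _))
    rw [inner_add_right, inner_smul_right, inner_smul_right, hi, div_mul_cancel₀ _ hd2] at hfin
    have := hc t ht0
    have h0 := norm_nonneg ⟪h i i, v⟫
    nlinarith
  · by_cases hj2 : ‖⟪h j i, v⟫‖ ^ 2 = α j i * (σ j) ^ 2
    · have hjT : h j i ∈ T := ⟨j, hj, hj2, rfl⟩
      rw [inner_add_right, inner_smul_right, inner_smul_right, hd1 _ hjT,
        hu1 _ (Submodule.subset_span (Set.mem_insert_of_mem _ hjT)), mul_zero, mul_zero, add_zero]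
      exact hj2.le
    · exact (ht j hj hj2).le
end

section
/- (Three-user SOPC solution, first case.) Let h_{11}, h_{21}, h_{31} ∈ ℂ^N with h_{11} ≠ 0, let P_1 > 0 and α_{21}σ_2², α_{31}σ_3² ≥ 0, and let v_1^{MF} = h_{11}/‖h_{11}‖. Assume ⟨h_{21}, v_1^{MF}⟩ ≠ 0 and ⟨h_{31}, v_1^{MF}⟩ ≠ 0, the ordering condition |⟨h_{31}, v_1^{MF}⟩|² / |⟨h_{21}, v_1^{MF}⟩|² ≥ α_{31}σ_3² / α_{21}σ_2² (with α_{21}σ_2² > 0), and √P_1 ≤ β_0, where β_0 = √(α_{31}σ_3²)/|⟨h_{31}, v_1^{MF}⟩|. Then the full-power matched-filter beam √P_1 · v_1^{MF} lies in the feasible set F_1 = {v ∈ ℂ^N : |⟨h_{21}, v⟩|² ≤ α_{21}σ_2², |⟨h_{31}, v⟩|² ≤ α_{31}σ_3², ‖v‖² ≤ P_1} and maximizes |⟨h_{11}, v⟩|² over F_1. -/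
open scoped ComplexInnerProductSpace

/-- The matched-filter direction `h₁₁/‖h₁₁‖`. -/
noncomputable def vMF {N : ℕ} (h11 : EuclideanSpace ℂ (Fin N)) : EuclideanSpace ℂ (Fin N) :=
  ‖h11‖⁻¹ • h11

/-- Three-user SOPC solution, first case: when `√P₁ ≤ β₀` (together with the ordering
condition between the two leakage constraints), the full-power matched-filter beam
`√P₁ · v₁^{MF}` is feasible and maximizes `|⟨h₁₁, ·⟩|²` over the three-user RZF
feasible set. -/
theorem three_user_SOPC_case1 {N : ℕ} (h11 h21 h31 : EuclideanSpace ℂ (Fin N))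
    (hh : h11 ≠ 0) (P1 : ℝ) (hP1 : 0 < P1) (ασ2 ασ3 : ℝ)
    (hασ2 : 0 < ασ2) (hασ3 : 0 ≤ ασ3)
    (hne2 : (⟪h21, vMF h11⟫ : ℂ) ≠ 0) (hne3 : (⟪h31, vMF h11⟫ : ℂ) ≠ 0)
    (horder : ‖⟪h31, vMF h11⟫‖ ^ 2 / ‖⟪h21, vMF h11⟫‖ ^ 2 ≥ ασ3 / ασ2)
    (hpow : Real.sqrt P1 ≤ Real.sqrt ασ3 / ‖⟪h31, vMF h11⟫‖) :
    ((‖⟪h21, Real.sqrt P1 • vMF h11⟫‖ ^ 2 ≤ ασ2 ∧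
        ‖⟪h31, Real.sqrt P1 • vMF h11⟫‖ ^ 2 ≤ ασ3) ∧
      ‖Real.sqrt P1 • vMF h11‖ ^ 2 ≤ P1) ∧
    ∀ v : EuclideanSpace ℂ (Fin N),
      ‖⟪h21, v⟫‖ ^ 2 ≤ ασ2 → ‖⟪h31, v⟫‖ ^ 2 ≤ ασ3 → ‖v‖ ^ 2 ≤ P1 →
      ‖⟪h11, v⟫‖ ^ 2 ≤ ‖⟪h11, Real.sqrt P1 • vMF h11⟫‖ ^ 2 := by
  have hs : ∀ h w : EuclideanSpace ℂ (Fin N),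
      ‖(⟪h, Real.sqrt P1 • w⟫ : ℂ)‖ ^ 2 = P1 * ‖(⟪h, w⟫ : ℂ)‖ ^ 2 := by
    intro h w
    rw [inner_smul_right_eq_smul, norm_smul, mul_pow, Real.norm_eq_abs, sq_abs,
      Real.sq_sqrt hP1.le]
  have hn : 0 < ‖h11‖ := norm_pos_iff.mpr hh
  have hv : ‖vMF h11‖ = 1 := by
    unfold vMF
    rw [norm_smul, norm_inv, norm_norm, inv_mul_cancel₀ hn.ne']
  have h11v : ‖(⟪h11, vMF h11⟫ : ℂ)‖ = ‖h11‖ := by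
    unfold vMF
    rw [inner_smul_right_eq_smul, norm_smul, norm_inv, norm_norm, inner_self_eq_norm_sq_to_K,
      norm_pow]
    simp
    field_simp
  have ha : 0 < ‖(⟪h21, vMF h11⟫ : ℂ)‖ := norm_pos_iff.mpr hne2
  have hb : 0 < ‖(⟪h31, vMF h11⟫ : ℂ)‖ := norm_pos_iff.mpr hne3
  have h3 : P1 * ‖(⟪h31, vMF h11⟫ : ℂ)‖ ^ 2 ≤ ασ3 := by
    rw [le_div_iff₀ hb] at hpow
    have := pow_le_pow_left₀ (by positivity) hpow 2
    rwa [mul_pow, Real.sq_sqrt hP1.le, Real.sq_sqrt hασ3] at this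
  rw [hs, hs, hs]
  refine ⟨⟨⟨?_, h3⟩, ?_⟩, ?_⟩
  · rw [ge_iff_le, div_le_div_iff₀ hασ2 (by positivity)] at horder
    have hb2 : 0 < ‖(⟪h31, vMF h11⟫ : ℂ)‖ ^ 2 := by positivity
    have ha2 : 0 < ‖(⟪h21, vMF h11⟫ : ℂ)‖ ^ 2 := by positivity
    have := mul_le_mul_of_nonneg_right h3 ha2.le
    refine le_of_mul_le_mul_left ?_ hb2
    linarith
  · rw [norm_smul, hv, mul_one, Real.norm_eq_abs, sq_abs, Real.sq_sqrt hP1.le]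
  · intro v _ _ hvP
    rw [h11v]
    have := pow_le_pow_left₀ (norm_nonneg _) (norm_inner_le_norm (𝕜 := ℂ) h11 v) 2
    rw [mul_pow] at this
    nlinarith [mul_le_mul_of_nonneg_left hvP (sq_nonneg ‖h11‖)]
end

section
/- (MIMO rate lower bound under relaxed zero-forcing.) Let M, N, d be positive integers, H an M×N complex matrix, V an N×d complex matrix, and set A = H V Vᴴ Hᴴ. Let σ > 0 and ε ≥ 0, and let B be an M×M Hermitian positive-semidefinite matrix with trace(B) ≤ ε σ². Then det( I_M + (σ² I_M + B)⁻¹ A ) ≥ det( I_M + (1/(σ²(1 + ε))) A ), where both determinants are real numbers ≥ 1; consequently log det( I_M + (σ² I_M + B)⁻¹ A ) ≥ log det( I_M + (1/(σ²(1 + ε))) A ). -/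
open Matrix
open scoped ComplexOrder


lemma aux_spec {n : Type*} [Fintype n] [DecidableEq n] {Q : Matrix n n ℂ} (hQ : Q.PosSemidef)
    : ∃ (U W : Matrix n n ℂ) (l : n → ℝ), W = Uᴴ ∧ U * W = 1 ∧ W * U = 1 ∧ (∀ i, 0 ≤ l i) ∧
      Q = U * diagonal (fun i => (l i : ℂ)) * W := by
  refine ⟨hQ.1.eigenvectorUnitary, _, hQ.1.eigenvalues, rfl, ?_, ?_, hQ.eigenvalues_nonneg, ?_⟩
  · exact Unitary.coe_mul_star_self hQ.1.eigenvectorUnitary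
  · exact Unitary.coe_star_mul_self hQ.1.eigenvectorUnitary
  · have h := hQ.1.spectral_theorem
    rw [Unitary.conjStarAlgAut_apply] at h
    exact h

lemma aux_one_le_det {n : Type*} [Fintype n] [DecidableEq n] {Q : Matrix n n ℂ}
    (hQ : Q.PosSemidef) : 1 ≤ (1 + Q).det := by
  obtain ⟨U, W, l, -, h1, h2, hl, rfl⟩ := aux_spec hQ
  have e : 1 + U * diagonal (fun i => (l i : ℂ)) * W
      = U * diagonal (fun i => ((1 + l i : ℝ) : ℂ)) * W := by
    have : diagonal (fun i => ((1 + l i : ℝ) : ℂ)) = 1 + diagonal (fun i => (l i : ℂ)) := by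
      rw [← diagonal_one, diagonal_add]; simp
    rw [this, mul_add, add_mul, mul_one, h1]
  rw [e, det_mul, det_mul, mul_right_comm, ← det_mul, h1, det_one, one_mul, det_diagonal,
    ← Complex.ofReal_prod]
  have : (1 : ℝ) ≤ ∏ i, (1 + l i) := by
    calc (1 : ℝ) = ∏ _i : n, (1 : ℝ) := by simp
      _ ≤ _ := Finset.prod_le_prod (fun _ _ => zero_le_one) (fun i _ => by linarith [hl i])
  exact_mod_cast this

lemma aux_det_mono {n : Type*} [Fintype n] [DecidableEq n] {P Q : Matrix n n ℂ}
    (hP : P.PosDef) (hQ : Q.PosSemidef) : P.det ≤ (P + Q).det := by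
  obtain ⟨U, W, l, hW, h1, h2, hl, e⟩ := aux_spec hQ
  set R := diagonal (fun i => (Real.sqrt (l i) : ℂ)) * W with hR
  have hQR : Q = Rᴴ * R := by
    have : diagonal (fun i => (l i : ℂ)) = diagonal (fun i => (Real.sqrt (l i) : ℂ)) *
        diagonal (fun i => (Real.sqrt (l i) : ℂ)) := by
      rw [diagonal_mul_diagonal]
      congr 1; ext i
      rw [← Complex.ofReal_mul, Real.mul_self_sqrt (hl i)]
    rw [e, hR, this, conjTranspose_mul, hW, conjTranspose_conjTranspose, diagonal_conjTranspose]
    have h3 : star (fun i => (Real.sqrt (l i) : ℂ)) = (fun i => (Real.sqrt (l i) : ℂ)) := by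
      ext i; simp
    rw [h3]
    simp only [Matrix.mul_assoc]
  have hu : IsUnit P.det := (isUnit_iff_isUnit_det _).1 hP.isUnit
  have e2 : P + Q = P * (1 + (P⁻¹ * Rᴴ) * R) := by
    rw [mul_add, mul_one, Matrix.mul_assoc, ← Matrix.mul_assoc P, mul_nonsing_inv _ hu, one_mul, hQR]
  rw [e2, det_mul, det_one_add_mul_comm]
  have := aux_one_le_det (hP.inv.posSemidef.mul_mul_conjTranspose_same R)
  rw [← Matrix.mul_assoc]
  calc P.det = P.det * 1 := (mul_one _).symm
    _ ≤ _ := mul_le_mul_of_nonneg_left this hP.det_pos.le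

lemma aux_trace {n : Type*} [Fintype n] [DecidableEq n] {Q : Matrix n n ℂ}
    (hQ : Q.PosSemidef) (t : ℝ) (ht : Q.trace.re ≤ t) :
    ((t : ℂ) • (1 : Matrix n n ℂ) - Q).PosSemidef := by
  obtain ⟨U, W, l, hW, h1, h2, hl, rfl⟩ := aux_spec hQ
  have e : (t : ℂ) • (1 : Matrix n n ℂ) - U * diagonal (fun i => (l i : ℂ)) * W
      = U * diagonal (fun i => ((t - l i : ℝ) : ℂ)) * W := by
    have : diagonal (fun i => ((t - l i : ℝ) : ℂ))
        = (t : ℂ) • (1 : Matrix n n ℂ) - diagonal (fun i => (l i : ℂ)) := by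
      rw [smul_one_eq_diagonal, diagonal_sub]; simp
    rw [this, mul_sub, sub_mul, mul_smul_comm, mul_one, smul_mul_assoc, h1]
  rw [e, hW]
  apply PosSemidef.mul_mul_conjTranspose_same
  apply PosSemidef.diagonal
  intro i
  rw [trace_mul_comm, ← Matrix.mul_assoc, h2, one_mul, trace_diagonal, ← Complex.ofReal_sum,
    Complex.ofReal_re] at ht
  have := Finset.single_le_sum (fun i _ => hl i) (Finset.mem_univ i)
  have h : 0 ≤ t - l i := by linarith
  exact Complex.zero_le_real.2 h

lemma aux_inv {n : Type*} [Fintype n] [DecidableEq n] {F : Matrix n n ℂ}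
    (hF : F.PosDef) (k : ℝ) (hk : 0 < k) (hS : ((k : ℂ) • (1 : Matrix n n ℂ) - F).PosSemidef) :
    (F⁻¹ - ((1 / k : ℝ) : ℂ) • (1 : Matrix n n ℂ)).PosSemidef := by
  have hu : IsUnit F.det := (isUnit_iff_isUnit_det _).1 hF.isUnit
  set S := (k : ℂ) • (1 : Matrix n n ℂ) - F with hSd
  have h1 := hF.inv.posSemidef.mul_mul_conjTranspose_same S
  rw [hS.1.eq] at h1
  have hk0 : (k : ℂ) ≠ 0 := by exact_mod_cast hk.ne'
  have e : F⁻¹ - ((1 / k : ℝ) : ℂ) • (1 : Matrix n n ℂ)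
      = (((1 / k) ^ 2 : ℝ) : ℂ) • (S + S * F⁻¹ * S) := by
    have : S + S * F⁻¹ * S = ((k : ℂ) ^ 2) • F⁻¹ - (k : ℂ) • 1 := by
      rw [hSd]
      simp only [sub_mul, mul_sub, smul_mul_assoc, mul_smul_comm, one_mul, mul_one,
        mul_nonsing_inv _ hu, nonsing_inv_mul _ hu, smul_sub, smul_smul]
      rw [sq]
      abel
    rw [this, smul_sub, smul_smul, smul_smul]
    push_cast
    congr 1
    · rw [← mul_pow, one_div_mul_cancel hk0, one_pow, one_smul]
    · congr 1; field_simp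
  rw [e]
  apply (hS.add h1).smul
  apply Complex.zero_le_real.2
  positivity

/-- MIMO rate lower bound under relaxed zero-forcing: for `A = H V Vᴴ Hᴴ` and a
Hermitian positive-semidefinite interference covariance `B` with
`trace(B) ≤ ε σ²`, one has
`det(I + (σ²I + B)⁻¹ A) ≥ det(I + A/(σ²(1+ε))) ≥ 1` (both real), hence the
corresponding log-det inequality. -/
theorem MIMO_RZF_rate_lower_bound {M N d : ℕ}
    (H : Matrix (Fin M) (Fin N) ℂ) (V : Matrix (Fin N) (Fin d) ℂ)
    (σ ε : ℝ) (hσ : 0 < σ) (hε : 0 ≤ ε)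
    (B : Matrix (Fin M) (Fin M) ℂ) (hB : B.PosSemidef)
    (htr : B.trace.re ≤ ε * σ ^ 2) :
    ∃ r s : ℝ,
      (1 + (((σ : ℂ) ^ 2) • (1 : Matrix (Fin M) (Fin M) ℂ) + B)⁻¹ *
          (H * V * Vᴴ * Hᴴ)).det = (r : ℂ) ∧
      (1 + (((1 / (σ ^ 2 * (1 + ε)) : ℝ) : ℂ)) •
          (H * V * Vᴴ * Hᴴ)).det = (s : ℂ) ∧
      1 ≤ s ∧ s ≤ r ∧ Real.log s ≤ Real.log r := by
  have hσ2 : 0 < σ ^ 2 := by positivity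
  have hk : 0 < σ ^ 2 * (1 + ε) := by positivity
  set c : ℝ := 1 / (σ ^ 2 * (1 + ε)) with hc
  have hc0 : 0 < c := by positivity
  set F := ((σ : ℂ) ^ 2) • (1 : Matrix (Fin M) (Fin M) ℂ) + B with hFd
  have hF : F.PosDef := by
    apply PosDef.add_posSemidef _ hB
    apply PosDef.one.smul
    have : (0 : ℂ) < ((σ ^ 2 : ℝ) : ℂ) := Complex.zero_lt_real.2 hσ2
    simpa using this
  have hS := aux_trace hB _ htr
  have hS' : (((σ ^ 2 * (1 + ε) : ℝ) : ℂ) • (1 : Matrix (Fin M) (Fin M) ℂ) - F).PosSemidef := by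
    convert hS using 1
    rw [hFd, ← sub_sub, ← sub_smul]
    congr 2
    push_cast
    ring
  have hI := aux_inv hF _ hk hS'
  rw [← hc] at hI
  set G := H * V with hG
  have hA : H * V * Vᴴ * Hᴴ = G * Gᴴ := by
    rw [hG, conjTranspose_mul, Matrix.mul_assoc (H * V)]
  rw [hA]
  have hGG : ((c : ℂ) • (Gᴴ * G)).PosSemidef :=
    (posSemidef_conjTranspose_mul_self G).smul (Complex.zero_le_real.2 hc0.le)
  have e1 : (1 + F⁻¹ * (G * Gᴴ)).det = (1 + Gᴴ * F⁻¹ * G).det := by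
    rw [← Matrix.mul_assoc, det_one_add_mul_comm, Matrix.mul_assoc]
  have e2 : (1 + (c : ℂ) • (G * Gᴴ)).det = (1 + (c : ℂ) • (Gᴴ * G)).det := by
    rw [← Matrix.smul_mul, det_one_add_mul_comm, Matrix.mul_smul]
  have e3 : 1 + Gᴴ * F⁻¹ * G
      = (1 + (c : ℂ) • (Gᴴ * G)) + Gᴴ * (F⁻¹ - (c : ℂ) • (1 : Matrix (Fin M) (Fin M) ℂ)) * G := by
    simp only [Matrix.mul_sub, Matrix.sub_mul, Matrix.mul_smul, Matrix.smul_mul, Matrix.mul_one]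
    abel
  have i1 := aux_one_le_det hGG
  have i2 := aux_det_mono (PosDef.one.add_posSemidef hGG) (hI.conjTranspose_mul_mul_same G)
  rw [← e3, ← e1, ← e2] at i2
  rw [← e2] at i1
  have i3 := i1.trans i2
  rw [Complex.le_def] at i1 i2 i3
  simp only [Complex.one_re, Complex.one_im] at i1 i3
  refine ⟨_, _, Complex.ext rfl ?_, Complex.ext rfl ?_, i1.1, i2.1, ?_⟩
  · simpa using i3.2.symm
  · simpa using i1.2.symm
  · exact Real.log_le_log (by linarith [i1.1]) i2.1
end
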